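/- arXiv:1811.04542 — 4 statements merged into one kernel-verified Lean document; each statement's English description precedes it below -/
import Mathlib

section
/- Let E be a finite directed graph without sinks, with a chosen special edge starting at each vertex. Then for every vertex i of E and every integer l, the set B^l_i of admissible pairs (p, q) with l(q) − l(p) = l and s(q) = i is nonempty. -/
open scoped Classical

/-- `IsPathOn s t v es` says that the list of edges `es` (in traversal order,
i.e. the first-applied edge first) forms a path starting at the vertex `v`
in the graph with source map `s` and target map `t`. -/
def IsPathOn {V E : Type} (s t : E → V) : V → List E → Prop
  | _, [] => True
  | v, a :: rest => s a = v ∧ IsPathOn s t (t a) rest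

/-- A path is encoded as a pair: its starting vertex together with its list of
edges in traversal order.  A trivial path `e_i` is `(i, [])`. -/
def IsPath {V E : Type} (s t : E → V) (p : V × List E) : Prop :=
  IsPathOn s t p.1 p.2

/-- The terminating vertex of a path. -/
def pterm {V E : Type} (t : E → V) (p : V × List E) : V :=
  p.2.getLast?.elim p.1 t

/-- `(p, q)` is an admissible pair with respect to the choice of special edges
`sp` (where `sp i` is the special edge starting at `i`): both are paths with the
same terminating vertex, and either one of them is trivial, or their last edges
are distinct, or their last edges are equal but not special. -/
def Admissible {V E : Type} (s t : E → V) (sp : V → E) (p q : V × List E) : Prop :=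
  IsPath s t p ∧ IsPath s t q ∧ pterm t p = pterm t q ∧
    (p.2 = [] ∨ q.2 = [] ∨
      ∃ a b, p.2.getLast? = some a ∧ q.2.getLast? = some b ∧
        (a ≠ b ∨ (a = b ∧ a ∉ Set.range sp)))

/-- The set `B^l_i` of admissible pairs `(p, q)` with `l(q) - l(p) = l` and `s(q) = i`. -/
def Bset {V E : Type} (s t : E → V) (sp : V → E) (i : V) (l : ℤ) :
    Set ((V × List E) × (V × List E)) :=
  {pq | Admissible s t sp pq.1 pq.2 ∧
    ((pq.2.2.length : ℤ) - (pq.1.2.length : ℤ) = l) ∧ pq.2.1 = i}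

/-- The walk of length `n` from `v` along special edges. -/
def spWalk {V E : Type} (t : E → V) (sp : V → E) : V → ℕ → List E
  | _, 0 => []
  | v, n + 1 => sp v :: spWalk t sp (t (sp v)) n

theorem spWalk_length {V E : Type} (t : E → V) (sp : V → E) (n : ℕ) :
    ∀ v, (spWalk t sp v n).length = n := by
  induction n with
  | zero => intro v; rfl
  | succ n ih => intro v; simp [spWalk, ih]

theorem spWalk_isPathOn {V E : Type} (s t : E → V) (sp : V → E)
    (hsp : ∀ i, s (sp i) = i) (n : ℕ) :
    ∀ v, IsPathOn s t v (spWalk t sp v n) := by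
  induction n with
  | zero => intro v; trivial
  | succ n ih => intro v; exact ⟨hsp v, ih _⟩

theorem spWalk_getLast {V E : Type} (t : E → V) (sp : V → E) (n : ℕ) :
    ∀ v, (spWalk t sp v (n + 1)).getLast? = some (sp ((fun x => t (sp x))^[n] v)) := by
  induction n with
  | zero => intro v; rfl
  | succ n ih =>
    intro v
    have h := ih (t (sp v))
    rw [spWalk, List.getLast?_cons, h]
    rfl

theorem spWalk_pterm {V E : Type} (t : E → V) (sp : V → E) (n : ℕ) (v : V) :
    pterm t (v, spWalk t sp v n) = (fun x => t (sp x))^[n] v := by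
  cases n with
  | zero => rfl
  | succ n =>
    simp only [pterm]
    rw [spWalk_getLast, Function.iterate_succ_apply']
    rfl

theorem exists_backward {V : Type} [Fintype V] (f : V → V) (i : V) (m : ℕ) :
    ∃ N u, f^[N + m] u = f^[N] i := by
  obtain ⟨a, b, hab, h⟩ : ∃ a b : ℕ, a < b ∧ f^[a] i = f^[b] i := by
    obtain ⟨a, b, hne, h⟩ := Finite.exists_ne_map_eq_of_infinite (fun n : ℕ => f^[n] i)
    rcases lt_or_gt_of_ne hne with hlt | hlt
    · exact ⟨a, b, hlt, h⟩
    · exact ⟨b, a, hlt, h.symm⟩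
  obtain ⟨d, rfl⟩ := Nat.exists_eq_add_of_lt hab
  have key : ∀ k : ℕ, f^[a + k * (d + 1)] i = f^[a] i := by
    intro k
    induction k with
    | zero => simp
    | succ k ih =>
      have e : a + (k + 1) * (d + 1) = k * (d + 1) + (a + d + 1) := by ring
      rw [e, Function.iterate_add_apply, ← h, ← Function.iterate_add_apply, add_comm, ih]
  refine ⟨a, f^[m * d] i, ?_⟩
  rw [← Function.iterate_add_apply, ← key m]
  congr 1
  ring_nf

/-- For a finite graph without sinks (witnessed by the choice `sp` of a special
edge starting at each vertex), the set `B^l_i` is nonempty for every vertex `i`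
and every integer `l`. -/
theorem Bset_nonempty {V E : Type} [Fintype V] [Fintype E] (s t : E → V)
    (sp : V → E) (hsp : ∀ i, s (sp i) = i) (i : V) (l : ℤ) :
    (Bset s t sp i l).Nonempty := by
  set f : V → V := fun x => t (sp x) with hf
  rcases le_total 0 l with hl | hl
  · obtain ⟨n, rfl⟩ := Int.eq_ofNat_of_zero_le hl
    refine ⟨((f^[n] i, []), (i, spWalk t sp i n)),
      ⟨trivial, spWalk_isPathOn s t sp hsp n i, ?_, Or.inl rfl⟩, ?_, rfl⟩
    · rw [spWalk_pterm]; rfl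
    · simp [spWalk_length]
  · obtain ⟨m, hm⟩ := Int.eq_ofNat_of_zero_le (neg_nonneg.mpr hl)
    have hex := exists_backward f i m
    obtain ⟨u, hu⟩ := Nat.find_spec hex
    have hmin := fun k => Nat.find_min hex (m := k)
    generalize Nat.find hex = N at hu hmin
    refine ⟨((u, spWalk t sp u (N + m)), (i, spWalk t sp i N)),
      ⟨spWalk_isPathOn s t sp hsp _ u, spWalk_isPathOn s t sp hsp _ i, ?_, ?_⟩, ?_, rfl⟩
    · rw [spWalk_pterm, spWalk_pterm]; exact hu
    · cases N with
      | zero => exact Or.inr (Or.inl rfl)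
      | succ N =>
        refine Or.inr (Or.inr ⟨sp (f^[N + m] u), sp (f^[N] i), ?_, spWalk_getLast t sp N i,
          Or.inl ?_⟩)
        · have e : N + 1 + m = N + m + 1 := by ring
          simp only [e]
          exact spWalk_getLast t sp (N + m) u
        · intro h
          apply hmin N (Nat.lt_succ_self N)
          refine ⟨u, ?_⟩
          have h' := congrArg s h
          rwa [hsp, hsp] at h'
    · simp only [spWalk_length]
      push_cast
      omega
end

section
/- Let E be a finite directed graph without sources, with a chosen associated edge terminating at each vertex. Then for every vertex i of E and every integer l, the set Λ^l_i of associated pairs (p, q) with l(q) − l(p) = l and t(p) = i is nonempty. -/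
open scoped Classical

/-- `(p, q)` is an associated pair with respect to the choice of associated
edges `asc` (where `asc i` is the associated edge terminating at `i`): both are
paths with the same starting vertex, and either one of them is trivial, or
their first edges are distinct, or their first edges are equal but not
associated. -/
def AssociatedPair {V E : Type} (s t : E → V) (asc : V → E) (p q : V × List E) : Prop :=
  IsPath s t p ∧ IsPath s t q ∧ p.1 = q.1 ∧
    (p.2 = [] ∨ q.2 = [] ∨
      ∃ a b, p.2.head? = some a ∧ q.2.head? = some b ∧
        (a ≠ b ∨ (a = b ∧ a ∉ Set.range asc)))

/-- The set `Λ^l_i` of associated pairs `(p, q)` with `l(q) - l(p) = l` and `t(p) = i`. -/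
def Lset {V E : Type} (s t : E → V) (asc : V → E) (i : V) (l : ℤ) :
    Set ((V × List E) × (V × List E)) :=
  {pq | AssociatedPair s t asc pq.1 pq.2 ∧
    ((pq.2.2.length : ℤ) - (pq.1.2.length : ℤ) = l) ∧ pterm t pq.1 = i}

theorem pterm_cons_aux {V E : Type} (t : E → V) (v : V) (a : E) (r : List E) :
    pterm t (v, a :: r) = pterm t (t a, r) := by
  cases r with
  | nil => simp [pterm]
  | cons b r => simp [pterm, List.getLast?_cons_cons, List.getLast?_cons]

theorem take_path_aux {V E : Type} (s t : E → V) (r : List E) :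
    ∀ (v : V) (n : ℕ), IsPathOn s t v r → IsPathOn s t v (r.take n) := by
  induction r with
  | nil => intro v n h; simpa using h
  | cons a r ih =>
    intro v n h
    cases n with
    | zero => simp [IsPathOn]
    | succ n => exact ⟨h.1, ih _ _ h.2⟩

/-- Walking backwards along associated edges. -/
theorem back_path_aux {V E : Type} (s t : E → V) (asc : V → E) (hasc : ∀ i, t (asc i) = i)
    (i : V) (k : ℕ) : ∃ r : List E, r.length = k ∧
      IsPathOn s t ((fun v => s (asc v))^[k] i) r ∧
      pterm t ((fun v => s (asc v))^[k] i, r) = i := by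
  induction k with
  | zero => exact ⟨[], rfl, trivial, rfl⟩
  | succ k ih =>
    obtain ⟨r, h1, h2, h3⟩ := ih
    refine ⟨asc ((fun v => s (asc v))^[k] i) :: r, by simp [h1], ⟨?_, ?_⟩, ?_⟩
    · rw [Function.iterate_succ_apply']
    · rw [hasc]; exact h2
    · rw [pterm_cons_aux, hasc]; exact h3

/-- Cancelling the common initial part of two paths. -/
theorem cancel_aux {V E : Type} (s t : E → V) (asc : V → E) (i : V) (l : ℤ) (p : List E) :
    ∀ (q : List E) (v : V), IsPathOn s t v p → IsPathOn s t v q →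
      (q.length : ℤ) - (p.length : ℤ) = l → pterm t (v, p) = i →
      (Lset s t asc i l).Nonempty := by
  induction p with
  | nil =>
    intro q v hp hq hl ht
    exact ⟨((v, []), (v, q)), ⟨hp, hq, rfl, Or.inl rfl⟩, hl, ht⟩
  | cons a p ih =>
    intro q v hp hq hl ht
    cases q with
    | nil => exact ⟨((v, a :: p), (v, [])), ⟨hp, hq, rfl, Or.inr (Or.inl rfl)⟩, hl, ht⟩
    | cons b q =>
      by_cases hab : a = b
      · subst hab
        refine ih q (t a) hp.2 hq.2 ?_ ?_
        · simp only [List.length_cons] at hl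
          push_cast at hl
          omega
        · rw [← ht, pterm_cons_aux]
      · exact ⟨((v, a :: p), (v, b :: q)),
          ⟨hp, hq, rfl, Or.inr (Or.inr ⟨a, b, rfl, rfl, Or.inl hab⟩)⟩, hl, ht⟩

/-- For a finite graph without sources (witnessed by the choice `asc` of an
associated edge terminating at each vertex), the set `Λ^l_i` is nonempty for
every vertex `i` and every integer `l`. -/
theorem Lset_nonempty {V E : Type} [Fintype V] [Fintype E] (s t : E → V)
    (asc : V → E) (hasc : ∀ i, t (asc i) = i) (i : V) (l : ℤ) :
    (Lset s t asc i l).Nonempty := by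
  obtain ⟨v, hv⟩ := Finite.exists_infinite_fiber (fun k : ℕ => (fun v => s (asc v))^[k] i)
  have hinf := Set.infinite_coe_iff.mp hv
  obtain ⟨k, hk, hkl⟩ := hinf.exists_gt l.natAbs
  obtain ⟨m, hm, hml⟩ := hinf.exists_gt ((k : ℤ) + l).toNat
  obtain ⟨p, p1, p2, p3⟩ := back_path_aux s t asc hasc i k
  obtain ⟨q, q1, q2, -⟩ := back_path_aux s t asc hasc i m
  have hk' : (fun v => s (asc v))^[k] i = v := hk
  have hm' : (fun v => s (asc v))^[m] i = v := hm
  rw [hk'] at p2 p3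
  rw [hm'] at q2
  refine cancel_aux s t asc i l p (q.take ((k : ℤ) + l).toNat) v p2
    (take_path_aux s t q v _ q2) ?_ p3
  rw [List.length_take, p1, q1]
  omega
end

section
/- Let E be a finite directed graph without sinks and let S and S' be two choices of special edges. For every vertex i and every integer l, the map Φ_li : B^l_i → (B^l_i)' defined by Φ_li(p, q) = (α p̂, α q̂) if p and q both have length ≥ 1 and their last edges are both equal to the S'-special edge α' at some vertex (where p̂ and q̂ are p and q with their last edges removed, and α is the S-special edge with s(α) = s(α')), and Φ_li(p, q) = (p, q) otherwise, is a well-defined bijection from B^l_i onto (B^l_i)'. -/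
open scoped Classical

/-- The map `Φ` comparing admissible pairs for the two choices `sp` (the set
`S`) and `sp'` (the set `S'`) of special edges: if the last edges of `p` and
`q` coincide and are special with respect to `sp'`, replace both last edges by
the `sp`-special edge with the same starting vertex; otherwise do nothing. -/
noncomputable def PhiMap {V E : Type} (s : E → V) (sp sp' : V → E)
    (pq : (V × List E) × (V × List E)) : (V × List E) × (V × List E) :=
  match pq.1.2.getLast?, pq.2.2.getLast? with
  | some a, some b =>
    if a = b ∧ a ∈ Set.range sp' then
      ((pq.1.1, pq.1.2.dropLast ++ [sp (s a)]), (pq.2.1, pq.2.2.dropLast ++ [sp (s a)]))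
    else pq
  | _, _ => pq

theorem isPathOn_concat {V E : Type} (s t : E → V) (es : List E) (v : V) (a b : E)
    (hab : s a = s b) (h : IsPathOn s t v (es ++ [a])) : IsPathOn s t v (es ++ [b]) := by
  induction es generalizing v with
  | nil => simp only [List.nil_append, IsPathOn] at h ⊢; exact ⟨hab ▸ h.1, trivial⟩
  | cons c es ih =>
    simp only [List.cons_append, IsPathOn] at h ⊢
    exact ⟨h.1, ih _ h.2⟩

theorem PhiMap_aux {V E : Type} (s t : E → V)
    (sp sp' : V → E) (hsp : ∀ i, s (sp i) = i) (hsp' : ∀ i, s (sp' i) = i)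
    (i : V) (l : ℤ) (x : (V × List E) × (V × List E)) (hx : x ∈ Bset s t sp i l) :
    PhiMap s sp sp' x ∈ Bset s t sp' i l ∧ PhiMap s sp' sp (PhiMap s sp sp' x) = x := by
  obtain ⟨⟨v, p⟩, ⟨w, q⟩⟩ := x
  obtain ⟨⟨hp, hq, ht, ha⟩, hl, hi⟩ := hx
  simp only [IsPath] at hp hq ht ha hl hi
  rcases List.eq_nil_or_concat p with rfl | ⟨p, a, rfl⟩
  · have h1 : ∀ f g : V → E, PhiMap s f g ((v, []), (w, q)) = ((v, []), (w, q)) := by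
      intro f g; simp [PhiMap]
    rw [h1, h1]
    exact ⟨⟨⟨hp, hq, ht, Or.inl rfl⟩, hl, hi⟩, rfl⟩
  rcases List.eq_nil_or_concat q with rfl | ⟨q, b, rfl⟩
  · have h1 : ∀ f g : V → E, PhiMap s f g ((v, p ++ [a]), (w, [])) = ((v, p ++ [a]), (w, [])) := by
      intro f g; simp [PhiMap]
    simp only [List.concat_eq_append] at *
    rw [h1, h1]
    exact ⟨⟨⟨hp, hq, ht, Or.inr (Or.inl rfl)⟩, hl, hi⟩, rfl⟩
  simp only [List.concat_eq_append] at *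
  have hP : ∀ (f g : V → E) (a b : E), PhiMap s f g ((v, p ++ [a]), (w, q ++ [b])) =
      if a = b ∧ a ∈ Set.range g then ((v, p ++ [f (s a)]), (w, q ++ [f (s a)]))
      else ((v, p ++ [a]), (w, q ++ [b])) := by
    intro f g a b; simp [PhiMap]
  have hab : a ≠ b ∨ (a = b ∧ a ∉ Set.range sp) := by
    simpa using ha
  rw [hP]
  by_cases hc : a = b ∧ a ∈ Set.range sp'
  · obtain ⟨rfl, u, rfl⟩ := hc
    have hn : sp' u ∉ Set.range sp := by simpa using hab
    rw [if_pos ⟨rfl, u, rfl⟩, hsp', hP, if_pos ⟨rfl, u, rfl⟩, hsp]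
    refine ⟨⟨⟨?_, ?_, ?_, ?_⟩, ?_, hi⟩, rfl⟩
    · exact isPathOn_concat s t p v _ _ (by rw [hsp, hsp']) hp
    · exact isPathOn_concat s t q w _ _ (by rw [hsp, hsp']) hq
    · simp [pterm]
    · refine Or.inr (Or.inr ⟨sp u, sp u, by simp, by simp, Or.inr ⟨rfl, ?_⟩⟩)
      rintro ⟨z, hz⟩
      have : z = u := by rw [← hsp' z, hz, hsp]
      subst this
      exact hn ⟨z, hz.symm⟩
    · simpa using hl
  · rw [if_neg hc, hP, if_neg (by tauto)]
    refine ⟨⟨⟨hp, hq, ht, Or.inr (Or.inr ⟨a, b, by simp, by simp, by tauto⟩)⟩, hl, hi⟩, rfl⟩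

/-- For two choices `sp` and `sp'` of special edges of a finite graph without
sinks, the map `Φ_{li}` is a well-defined bijection from `B^l_i` onto `(B^l_i)'`. -/
theorem PhiMap_bijOn {V E : Type} [Fintype V] [Fintype E] (s t : E → V)
    (sp sp' : V → E) (hsp : ∀ i, s (sp i) = i) (hsp' : ∀ i, s (sp' i) = i)
    (i : V) (l : ℤ) :
    Set.BijOn (PhiMap s sp sp') (Bset s t sp i l) (Bset s t sp' i l) := by
  have h1 := PhiMap_aux s t sp sp' hsp hsp' i l
  have h2 := PhiMap_aux s t sp' sp hsp' hsp i l
  exact Set.BijOn.mk (fun x hx => (h1 x hx).1)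
    (fun x hx y hy hxy => by rw [← (h1 x hx).2, hxy, (h1 y hy).2])
    (fun y hy => ⟨_, (h2 y hy).1, (h2 y hy).2⟩)
end

section
/- Let E be a finite directed graph without sources and let H and H' be two choices of associated edges. For every vertex i and every integer l, the map τ_li : Λ^l_i → (Λ^l_i)' defined by τ_li(p, q) = (p̃α, q̃α) if p and q both have length ≥ 1 and their first edges are both equal to the H'-associated edge α' at some vertex (where p̃ and q̃ are p and q with their first edges removed, and α is the H-associated edge with t(α) = t(α')), and τ_li(p, q) = (p, q) otherwise, is a well-defined bijection from Λ^l_i onto (Λ^l_i)'. -/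
open scoped Classical

/-- The map `τ` comparing associated pairs for the two choices `asc` (the set
`H`) and `asc'` (the set `H'`) of associated edges: if the first edges of `p`
and `q` coincide and are associated with respect to `asc'`, replace both first
edges by the `asc`-associated edge with the same terminating vertex; otherwise
do nothing. -/
noncomputable def TauMap {V E : Type} (s t : E → V) (asc asc' : V → E)
    (pq : (V × List E) × (V × List E)) : (V × List E) × (V × List E) :=
  match pq.1.2.head?, pq.2.2.head? with
  | some a, some b =>
    if a = b ∧ a ∈ Set.range asc' then
      ((s (asc (t a)), asc (t a) :: pq.1.2.tail), (s (asc (t a)), asc (t a) :: pq.2.2.tail))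
    else pq
  | _, _ => pq

theorem asc_not_mem {V E : Type} (t : E → V)
    (asc asc' : V → E) (hasc : ∀ i, t (asc i) = i) (hasc' : ∀ i, t (asc' i) = i)
    (v : V) (h : asc' v ∉ Set.range asc) : asc v ∉ Set.range asc' := by
  rintro ⟨w, hw⟩
  have h1 : w = v := by rw [← hasc' w, hw, hasc]
  subst h1
  exact h ⟨w, hw.symm⟩

theorem pterm_cons {V E : Type} (t : E → V) (v w : V) (a b : E) (h : t a = t b) (L : List E) :
    pterm t (v, a :: L) = pterm t (w, b :: L) := by
  cases L <;> simp [pterm, h, List.getLast?_cons_cons, List.getLast?_cons]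

theorem TauMap_mapsTo {V E : Type} (s t : E → V)
    (asc asc' : V → E) (hasc : ∀ i, t (asc i) = i) (hasc' : ∀ i, t (asc' i) = i)
    (i : V) (l : ℤ) :
    Set.MapsTo (TauMap s t asc asc') (Lset s t asc i l) (Lset s t asc' i l) := by
  rintro ⟨⟨v, p⟩, ⟨w, q⟩⟩ ⟨⟨hp, hq, hvw, h⟩, hl, ht⟩
  dsimp only at hp hq hvw h hl ht
  rcases p with _ | ⟨a, p⟩
  · exact ⟨⟨hp, hq, hvw, Or.inl rfl⟩, hl, ht⟩
  rcases q with _ | ⟨b, q⟩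
  · exact ⟨⟨hp, hq, hvw, Or.inr (Or.inl rfl)⟩, hl, ht⟩
  by_cases hab : a = b ∧ a ∈ Set.range asc'
  · obtain ⟨rfl, u, rfl⟩ := hab
    have hn : asc' u ∉ Set.range asc := by simpa using h
    have := asc_not_mem t asc asc' hasc hasc' u hn
    simp only [TauMap, List.head?_cons, Set.mem_range_self, and_self, if_true, List.tail_cons,
      hasc']
    have hp2 : IsPathOn s t (t (asc' u)) p := hp.2
    have hq2 : IsPathOn s t (t (asc' u)) q := hq.2
    rw [hasc'] at hp2 hq2
    refine ⟨⟨⟨rfl, ?_⟩, ⟨rfl, ?_⟩, rfl, Or.inr (Or.inr ⟨_, _, rfl, rfl, Or.inr ⟨rfl, this⟩⟩)⟩,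
      by simpa using hl, ?_⟩
    · rwa [hasc]
    · rwa [hasc]
    · rw [← ht]
      exact pterm_cons t _ _ _ _ (by rw [hasc, hasc']) p
  · have : TauMap s t asc asc' ((v, a :: p), (w, b :: q)) = ((v, a :: p), (w, b :: q)) := by
      simp only [TauMap, List.head?_cons, if_neg hab]
    rw [this]
    refine ⟨⟨hp, hq, hvw, Or.inr (Or.inr ⟨a, b, rfl, rfl, ?_⟩)⟩, hl, ht⟩
    by_cases e : a = b
    · exact Or.inr ⟨e, fun h => hab ⟨e, h⟩⟩
    · exact Or.inl e

theorem TauMap_leftInv {V E : Type} (s t : E → V)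
    (asc asc' : V → E) (hasc : ∀ i, t (asc i) = i) (hasc' : ∀ i, t (asc' i) = i)
    (i : V) (l : ℤ) :
    Set.LeftInvOn (TauMap s t asc' asc) (TauMap s t asc asc') (Lset s t asc i l) := by
  rintro ⟨⟨v, p⟩, ⟨w, q⟩⟩ ⟨⟨hp, hq, hvw, h⟩, hl, ht⟩
  dsimp only at hp hq hvw h hl ht
  rcases p with _ | ⟨a, p⟩
  · rfl
  rcases q with _ | ⟨b, q⟩
  · rfl
  by_cases hab : a = b ∧ a ∈ Set.range asc'
  · obtain ⟨rfl, u, rfl⟩ := hab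
    have h1 : s (asc' u) = v := hp.1
    have h2 : s (asc' u) = w := hq.1
    simp only [TauMap, List.head?_cons, Set.mem_range_self, and_self, if_true, List.tail_cons,
      hasc', hasc, ← h1, ← h2]
  · have : TauMap s t asc asc' ((v, a :: p), (w, b :: q)) = ((v, a :: p), (w, b :: q)) := by
      simp only [TauMap, List.head?_cons, if_neg hab]
    rw [this]
    have h3 : ¬ (a = b ∧ a ∈ Set.range asc) := by
      rintro ⟨rfl, h4⟩
      simp at h
      simp at h4
      obtain ⟨y, hy⟩ := h4
      exact h y hy
    simp only [TauMap, List.head?_cons, if_neg h3]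

/-- For two choices `asc` and `asc'` of associated edges of a finite graph
without sources, the map `τ_{li}` is a well-defined bijection from `Λ^l_i`
onto `(Λ^l_i)'`. -/
theorem TauMap_bijOn {V E : Type} [Fintype V] [Fintype E] (s t : E → V)
    (asc asc' : V → E) (hasc : ∀ i, t (asc i) = i) (hasc' : ∀ i, t (asc' i) = i)
    (i : V) (l : ℤ) :
    Set.BijOn (TauMap s t asc asc') (Lset s t asc i l) (Lset s t asc' i l) := by
  exact Set.InvOn.bijOn
    ⟨TauMap_leftInv s t asc asc' hasc hasc' i l, TauMap_leftInv s t asc' asc hasc' hasc i l⟩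
    (TauMap_mapsTo s t asc asc' hasc hasc' i l) (TauMap_mapsTo s t asc' asc hasc' hasc i l)
end
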